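/- arXiv:1912.13041 — 3 statements merged into one kernel-verified Lean document; each statement's English description precedes it below -/
import Mathlib

section
/- Let σ : [0,1] → {-1,1} be a step function with n jumps and let σ(d) = Σ_{k=1}^d ⟨e_k,σ⟩ e_k denote its projection onto the span of the first d Fourier basis vectors e_1,…,e_d. Then ‖σ − σ(d)‖²_{L²([0,1])} ≤ 4n/√d. -/
open Real Set

/-- The standard Fourier basis of `L²([0,1])` (indexed from `1`):
`e 1 = 1`, `e (2k) t = √2 sin(2πkt)`, `e (2k+1) t = √2 cos(2πkt)`. -/
noncomputable def fourierE (m : ℕ) (t : ℝ) : ℝ :=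
  if m = 1 then 1
  else if m % 2 = 0 then Real.sqrt 2 * Real.sin (2 * π * (m / 2 : ℕ) * t)
  else Real.sqrt 2 * Real.cos (2 * π * (m / 2 : ℕ) * t)

/-- A summable family on `ℤ` with inverse-square decay is controlled by its central part. -/
theorem hasSum_int_add_zero_le {f : ℤ → ℝ} {S C : ℝ} (hf : HasSum f S)
    (hC : 0 ≤ C) (hbound : ∀ m : ℤ, m ≠ 0 → f m ≤ C / (m : ℝ) ^ 2) {K : ℕ} (hK : 1 ≤ K) :
    S + f 0 ≤ ∑ k ∈ Finset.range K, (f k + f (-k)) + 4 * C / K := by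
  refine le_of_tendsto hf.nat_add_neg.tendsto_sum_nat ?_
  filter_upwards [Filter.eventually_ge_atTop K] with N hN
  rw [← Finset.sum_range_add_sum_Ico _ hN]
  gcongr
  have hIco : Finset.Ico K N = Finset.Ioo (K - 1) N := by ext x; simp; omega
  calc ∑ k ∈ Finset.Ico K N, (f k + f (-k))
      ≤ ∑ k ∈ Finset.Ico K N, 2 * C * ((k : ℝ) ^ 2)⁻¹ := by
        refine Finset.sum_le_sum fun k hk => ?_
        have hk0 : (k : ℤ) ≠ 0 := by have := (Finset.mem_Ico.1 hk).1; omega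
        have h1 := hbound k hk0
        have h2 := hbound (-k) (neg_ne_zero.2 hk0)
        push_cast at h1 h2
        rw [neg_sq] at h2
        rw [div_eq_mul_inv] at h1 h2
        linarith
    _ = 2 * C * ∑ k ∈ Finset.Ioo (K - 1) N, ((k : ℝ) ^ 2)⁻¹ := by rw [Finset.mul_sum, hIco]
    _ ≤ 2 * C * (2 / (((K - 1 : ℕ) : ℝ) + 1)) := by
        gcongr
        exact sum_Ioo_inv_sq_le _ _
    _ = 4 * C / K := by
        have : (((K - 1 : ℕ) : ℝ) + 1) = K := by exact_mod_cast Nat.sub_add_cancel hK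
        rw [this]; ring

/-- The integral over `[0,1]` of `σ` against the character `t ↦ exp (2πimt)`. -/
noncomputable def characterIntegral (σ : ℝ → ℝ) (m : ℤ) : ℂ :=
  ∫ t in (0:ℝ)..1, Complex.exp (2 * π * Complex.I * m * t) * σ t

theorem norm_integral_exp_mul_le_of_eqOn_const {σ : ℝ → ℝ} {x y c : ℝ} (hxy : x ≤ y)
    (hc : |c| = 1) (hσ : ∀ t ∈ Ioo x y, σ t = c) {m : ℤ} (hm : m ≠ 0) :
    ‖∫ t in x..y, Complex.exp (2 * π * Complex.I * m * t) * σ t‖ ≤ 1 / (π * |(m : ℝ)|) := by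
  have hconst : ∫ t in x..y, Complex.exp (2 * π * Complex.I * m * t) * σ t =
      ∫ t in x..y, Complex.exp (2 * π * Complex.I * m * t) * c :=
    intervalIntegral.integral_congr_Ioo_of_le hxy fun t ht => by simp only [hσ t ht]
  have hne : 2 * π * Complex.I * m ≠ 0 := by simp [hm, Real.pi_ne_zero]
  have hexp : ∀ z : ℝ, ‖Complex.exp (2 * π * Complex.I * m * z)‖ = 1 := fun z => by
    rw [← Complex.norm_exp_ofReal_mul_I (2 * π * m * z)]
    congr 2
    push_cast
    ring
  have hnorm : ‖2 * π * Complex.I * (m : ℂ)‖ = 2 * (π * |(m : ℝ)|) := by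
    simp [abs_of_pos Real.pi_pos, mul_assoc]
  rw [hconst, intervalIntegral.integral_mul_const, integral_exp_mul_complex hne, norm_mul,
    Complex.norm_real, Real.norm_eq_abs, hc, mul_one, norm_div, hnorm]
  have hpos : 0 < π * |(m : ℝ)| := by positivity
  rw [div_le_div_iff₀ (by positivity) hpos]
  have := norm_sub_le (Complex.exp (2 * π * Complex.I * m * y))
    (Complex.exp (2 * π * Complex.I * m * x))
  rw [hexp, hexp] at this
  nlinarith

theorem IntervalIntegrable.complex_ofReal {f : ℝ → ℝ} {x y : ℝ}
    (hf : IntervalIntegrable f MeasureTheory.volume x y) :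
    IntervalIntegrable (fun t => (f t : ℂ)) MeasureTheory.volume x y :=
  ⟨hf.1.ofReal, hf.2.ofReal⟩

theorem intervalIntegrable_exp_mul {σ : ℝ → ℝ} {x y : ℝ}
    (hσ : IntervalIntegrable σ MeasureTheory.volume x y) (m : ℤ) :
    IntervalIntegrable (fun t : ℝ => Complex.exp (2 * π * Complex.I * m * t) * σ t)
      MeasureTheory.volume x y :=
  IntervalIntegrable.continuousOn_mul hσ.complex_ofReal (by fun_prop)

theorem norm_characterIntegral_le {σ : ℝ → ℝ} {p : ℕ → ℝ} {N : ℕ} (hp0 : p 0 = 0)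
    (hpN : p N = 1) (hp : ∀ k < N, p k ≤ p (k + 1))
    (hint : ∀ k < N, IntervalIntegrable σ MeasureTheory.volume (p k) (p (k + 1)))
    (hσ : ∀ k < N, ∃ c : ℝ, |c| = 1 ∧ ∀ t ∈ Ioo (p k) (p (k + 1)), σ t = c)
    {m : ℤ} (hm : m ≠ 0) :
    ‖characterIntegral σ m‖ ≤ N / (π * |(m : ℝ)|) := by
  rw [characterIntegral, ← hp0, ← hpN, ← intervalIntegral.sum_integral_adjacent_intervals
    fun k hk => intervalIntegrable_exp_mul (hint k hk) m]
  calc _ ≤ ∑ _k ∈ Finset.range N, 1 / (π * |(m : ℝ)|) := by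
        refine norm_sum_le_of_le _ fun k hk => ?_
        obtain ⟨c, hc, hcσ⟩ := hσ k (Finset.mem_range.1 hk)
        exact norm_integral_exp_mul_le_of_eqOn_const (hp k (Finset.mem_range.1 hk)) hc hcσ hm
    _ = N / (π * |(m : ℝ)|) := by simp [div_eq_mul_inv]

theorem norm_characterIntegral_sq {σ : ℝ → ℝ}
    (hσ : IntervalIntegrable σ MeasureTheory.volume 0 1) (m : ℤ) :
    ‖characterIntegral σ m‖ ^ 2 = (∫ t in (0:ℝ)..1, Real.cos (2 * π * m * t) * σ t) ^ 2
      + (∫ t in (0:ℝ)..1, Real.sin (2 * π * m * t) * σ t) ^ 2 := by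
  have hcos : IntervalIntegrable (fun t => ((Real.cos (2 * π * m * t) * σ t : ℝ) : ℂ))
      MeasureTheory.volume 0 1 :=
    IntervalIntegrable.complex_ofReal (IntervalIntegrable.continuousOn_mul hσ (by fun_prop))
  have hsin : IntervalIntegrable (fun t => ((Real.sin (2 * π * m * t) * σ t : ℝ) : ℂ))
      MeasureTheory.volume 0 1 :=
    IntervalIntegrable.complex_ofReal (IntervalIntegrable.continuousOn_mul hσ (by fun_prop))
  have h : characterIntegral σ m =
      ((∫ t in (0:ℝ)..1, Real.cos (2 * π * m * t) * σ t : ℝ) : ℂ) +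
        ((∫ t in (0:ℝ)..1, Real.sin (2 * π * m * t) * σ t : ℝ) : ℂ) * Complex.I := by
    rw [← intervalIntegral.integral_ofReal, ← intervalIntegral.integral_ofReal,
      ← intervalIntegral.integral_mul_const,
      ← intervalIntegral.integral_add hcos (hsin.mul_const _), characterIntegral]
    refine intervalIntegral.integral_congr fun t _ => ?_
    have harg : 2 * π * Complex.I * m * t = ((2 * π * m * t : ℝ) : ℂ) * Complex.I := by
      push_cast; ring
    simp only [harg, Complex.exp_mul_I]
    push_cast
    ring
  rw [h, Complex.sq_norm, Complex.normSq_add_mul_I]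

theorem hasSum_norm_characterIntegral_sq {σ : ℝ → ℝ}
    (hσ : MeasureTheory.MemLp (fun t => (σ t : ℂ)) 2
      (MeasureTheory.volume.restrict (Ioc (0:ℝ) 1))) :
    HasSum (fun m : ℤ => ‖characterIntegral σ m‖ ^ 2) (∫ t in (0:ℝ)..1, σ t ^ 2) := by
  have h := (Equiv.neg ℤ).hasSum_iff.2 (hasSum_sq_fourierCoeffOn zero_lt_one hσ)
  have hcoeff : ∀ m : ℤ, fourierCoeffOn zero_lt_one (fun t => (σ t : ℂ)) (-m) =
      characterIntegral σ m := fun m => by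
    rw [fourierCoeffOn_eq_integral, characterIntegral]
    simp only [fourier_coe_apply, neg_neg, smul_eq_mul]
    simp
  simpa [Function.comp_def, hcoeff] using h

theorem fourierE_sq_add_sq {σ : ℝ → ℝ}
    (hσ : IntervalIntegrable σ MeasureTheory.volume 0 1) {k : ℕ} (hk : 1 ≤ k) :
    ‖characterIntegral σ k‖ ^ 2 + ‖characterIntegral σ (-k)‖ ^ 2 =
      (∫ t in (0:ℝ)..1, fourierE (2 * k) t * σ t) ^ 2
        + (∫ t in (0:ℝ)..1, fourierE (2 * k + 1) t * σ t) ^ 2 := by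
  have heven : ∀ t, fourierE (2 * k) t = √2 * Real.sin (2 * π * k * t) := fun t => by
    rw [fourierE, if_neg (by omega), if_pos (by omega)]
    simp
  have hodd : ∀ t, fourierE (2 * k + 1) t = √2 * Real.cos (2 * π * k * t) := fun t => by
    rw [fourierE, if_neg (by omega), if_neg (by omega), show (2 * k + 1) / 2 = k by omega]
  simp only [heven, hodd, mul_assoc √2, intervalIntegral.integral_const_mul, mul_pow,
    Real.sq_sqrt zero_le_two]
  rw [norm_characterIntegral_sq hσ, norm_characterIntegral_sq hσ]
  simp only [Int.cast_neg, Int.cast_natCast, mul_neg, neg_mul, Real.cos_neg, Real.sin_neg,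
    intervalIntegral.integral_neg, neg_sq]
  ring

theorem norm_characterIntegral_zero_sq {σ : ℝ → ℝ}
    (hσ : IntervalIntegrable σ MeasureTheory.volume 0 1) :
    ‖characterIntegral σ 0‖ ^ 2 = (∫ t in (0:ℝ)..1, fourierE 1 t * σ t) ^ 2 := by
  rw [norm_characterIntegral_sq hσ]
  simp [fourierE]

theorem sum_range_norm_characterIntegral_sq {σ : ℝ → ℝ}
    (hσ : IntervalIntegrable σ MeasureTheory.volume 0 1) {K : ℕ} (hK : 1 ≤ K) :
    ∑ k ∈ Finset.range K, (‖characterIntegral σ k‖ ^ 2 + ‖characterIntegral σ (-k)‖ ^ 2) =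
      ‖characterIntegral σ 0‖ ^ 2 +
        ∑ j ∈ Finset.Icc 1 (2 * K - 1), (∫ t in (0:ℝ)..1, fourierE j t * σ t) ^ 2 := by
  induction K, hK using Nat.le_induction with
  | base => simp [norm_characterIntegral_zero_sq hσ]
  | succ K hK ih =>
    rw [Finset.sum_range_succ, ih, fourierE_sq_add_sq hσ hK,
      show 2 * (K + 1) - 1 = 2 * K - 1 + 1 + 1 by omega, Finset.sum_Icc_succ_top (by omega),
      Finset.sum_Icc_succ_top (by omega), show 2 * K - 1 + 1 = 2 * K by omega]
    ring

/-- The projection error of a function whose Fourier coefficients decay like `1 / m` is `O(1 / d)`. -/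
theorem integral_sq_sub_sum_fourierE_le {σ : ℝ → ℝ} {C : ℝ}
    (hσ : IntervalIntegrable σ MeasureTheory.volume 0 1)
    (hL2 : MeasureTheory.MemLp (fun t => (σ t : ℂ)) 2
      (MeasureTheory.volume.restrict (Ioc (0:ℝ) 1)))
    (hC : 0 ≤ C) (hbound : ∀ m : ℤ, m ≠ 0 → ‖characterIntegral σ m‖ ^ 2 ≤ C / (m : ℝ) ^ 2)
    {d : ℕ} (hd : 1 ≤ d) :
    (∫ t in (0:ℝ)..1, σ t ^ 2)
        - ∑ k ∈ Finset.Icc 1 d, (∫ t in (0:ℝ)..1, fourierE k t * σ t) ^ 2 ≤ 8 * C / d := by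
  have hK : 1 ≤ (d + 1) / 2 := by omega
  have h := hasSum_int_add_zero_le (hasSum_norm_characterIntegral_sq hL2) hC hbound hK
  rw [sum_range_norm_characterIntegral_sq hσ hK] at h
  have hsub : ∑ j ∈ Finset.Icc 1 (2 * ((d + 1) / 2) - 1),
        (∫ t in (0:ℝ)..1, fourierE j t * σ t) ^ 2 ≤
      ∑ j ∈ Finset.Icc 1 d, (∫ t in (0:ℝ)..1, fourierE j t * σ t) ^ 2 :=
    Finset.sum_le_sum_of_subset_of_nonneg (Finset.Icc_subset_Icc_right (by omega))
      fun _ _ _ => sq_nonneg _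
  have hhalf : (d : ℝ) ≤ 2 * ((d + 1) / 2 : ℕ) := by
    have : d ≤ 2 * ((d + 1) / 2) := by omega
    exact_mod_cast this
  have hd' : (0:ℝ) < d := by exact_mod_cast hd
  have htail : 4 * C / ((d + 1) / 2 : ℕ) ≤ 8 * C / d := by
    rw [div_le_div_iff₀ (by linarith) hd']
    nlinarith
  linarith

/-- If `σ` is a `{-1,1}`-valued step function on `[0,1]` with `n` jumps
and `σ(d)` is its projection onto the span of the first `d` Fourier basis vectors,
then `‖σ - σ(d)‖² ≤ 4n/√d`. By Parseval and orthonormality,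
`‖σ - σ(d)‖² = ∫₀¹ σ(t)² dt - ∑_{k=1}^d ⟨e_k, σ⟩²`, which is the form stated here. -/
theorem projection_error_bound_of_step_path
    (n : ℕ) (σ : ℝ → ℝ)
    (hval : ∀ t ∈ Set.Ico (0:ℝ) 1, σ t = 1 ∨ σ t = -1)
    (a : Fin (n + 2) → ℝ)
    (ha0 : a 0 = 0) (ha1 : a (Fin.last (n + 1)) = 1) (hmono : StrictMono a)
    (hconst : ∀ i : Fin (n + 1),
      ∀ t ∈ Set.Ico (a i.castSucc) (a i.succ), σ t = σ (a i.castSucc))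
    (hjump : ∀ i : Fin n,
      σ (a i.castSucc.castSucc) ≠ σ (a i.succ.castSucc))
    (d : ℕ) (hd : 1 ≤ d) :
    (∫ t in (0:ℝ)..1, (σ t) ^ 2)
        - ∑ k ∈ Finset.Icc 1 d, (∫ t in (0:ℝ)..1, fourierE k t * σ t) ^ 2
      ≤ 4 * n / Real.sqrt d := by
  set p : ℕ → ℝ := fun k => a (Fin.ofNat (n + 2) k) with hp
  have hcast : ∀ k (hk : k < n + 1), Fin.ofNat (n + 2) k = (⟨k, hk⟩ : Fin (n + 1)).castSucc ∧
      Fin.ofNat (n + 2) (k + 1) = (⟨k, hk⟩ : Fin (n + 1)).succ := fun k hk => by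
    constructor <;> ext <;> simp [Fin.ofNat] <;> omega
  have hp0 : p 0 = 0 := by rw [← ha0]; rfl
  have hpN : p (n + 1) = 1 := by
    rw [← ha1]
    exact congrArg a (hcast n (Nat.lt_succ_self n)).2
  have hplt : ∀ k < n + 1, p k < p (k + 1) := fun k hk => by
    simp only [hp, hcast k hk]
    exact hmono Fin.castSucc_lt_succ
  have hpmem : ∀ k < n + 1, p k ∈ Ico (0:ℝ) 1 := fun k hk => by
    simp only [hp, hcast k hk]
    exact ⟨ha0 ▸ hmono.monotone (Fin.zero_le _), ha1 ▸ hmono (Fin.castSucc_lt_last _)⟩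
  have habs : ∀ t ∈ Ico (0:ℝ) 1, |σ t| = 1 := fun t ht => by
    rcases hval t ht with h | h <;> simp [h]
  have hpiece : ∀ k < n + 1, ∀ t ∈ Ioo (p k) (p (k + 1)), σ t = σ (p k) := fun k hk t ht => by
    simp only [hp, hcast k hk] at ht ⊢
    exact hconst _ t (Ioo_subset_Ico_self ht)
  have hint : ∀ k < n + 1, IntervalIntegrable σ MeasureTheory.volume (p k) (p (k + 1)) :=
    fun k hk => (intervalIntegrable_const (c := σ (p k))).congr_uIoo
      fun t ht => (hpiece k hk t (uIoo_of_le (hplt k hk).le ▸ ht)).symm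
  have hσ : IntervalIntegrable σ MeasureTheory.volume 0 1 := by
    rw [← hp0, ← hpN]
    exact IntervalIntegrable.trans_iterate hint
  have hL2 : MeasureTheory.MemLp (fun t => (σ t : ℂ)) 2
      (MeasureTheory.volume.restrict (Ioc (0:ℝ) 1)) := by
    refine MeasureTheory.MemLp.of_bound hσ.complex_ofReal.1.aestronglyMeasurable 1 ?_
    rw [← MeasureTheory.restrict_Ioo_eq_restrict_Ioc]
    refine (MeasureTheory.ae_restrict_mem measurableSet_Ioo).mono fun t ht => ?_
    rw [Complex.norm_real, Real.norm_eq_abs, habs t (Ioo_subset_Ico_self ht)]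
  have hone : ∫ t in (0:ℝ)..1, σ t ^ 2 = 1 := by
    rw [intervalIntegral.integral_congr_Ioo_of_le (g := fun _ => (1:ℝ)) zero_le_one
      fun t ht => by simp [← sq_abs (σ t), habs t (Ioo_subset_Ico_self ht)]]
    simp
  have hd' : (0:ℝ) < d := by exact_mod_cast hd
  have hs : 0 < √(d : ℝ) := Real.sqrt_pos.2 hd'
  have hss : √(d : ℝ) * √d = d := Real.mul_self_sqrt hd'.le
  rcases Nat.eq_zero_or_pos n with rfl | hn
  · have hfirst : (∫ t in (0:ℝ)..1, fourierE 1 t * σ t) ^ 2 = 1 := by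
      rw [intervalIntegral.integral_congr_Ioo_of_le (g := fun _ => σ (p 0)) zero_le_one
        fun t ht => by
          simpa [fourierE] using hpiece 0 one_pos t (by rwa [hp0, hpN])]
      simp [← sq_abs, habs _ (hpmem 0 one_pos)]
    have := Finset.single_le_sum (f := fun k => (∫ t in (0:ℝ)..1, fourierE k t * σ t) ^ 2)
      (fun _ _ => sq_nonneg _) (Finset.mem_Icc.2 ⟨le_refl 1, hd⟩)
    simp only [hfirst] at this
    simp only [Nat.cast_zero, mul_zero, zero_div, hone]
    linarith
  have hn' : (1:ℝ) ≤ n := by exact_mod_cast hn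
  rcases le_or_gt √(d : ℝ) (4 * n) with hsmall | hlarge
  · have hsum := Finset.sum_nonneg (s := Finset.Icc 1 d)
      fun k _ => sq_nonneg (∫ t in (0:ℝ)..1, fourierE k t * σ t)
    have : 1 ≤ 4 * n / √(d : ℝ) := (one_le_div hs).2 hsmall
    linarith
  · have hbound : ∀ m : ℤ, m ≠ 0 → ‖characterIntegral σ m‖ ^ 2 ≤
        (((n + 1 : ℕ) : ℝ) / π) ^ 2 / (m : ℝ) ^ 2 := fun m hm => by
      have := norm_characterIntegral_le hp0 hpN (fun k hk => (hplt k hk).le) hint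
        (fun k hk => ⟨_, habs _ (hpmem k hk), hpiece k hk⟩) hm
      rw [← sq_abs (m : ℝ), ← div_pow, div_div]
      gcongr
    refine (integral_sq_sub_sum_fourierE_le hσ hL2 (sq_nonneg _) hbound hd).trans ?_
    have hC : (((n + 1 : ℕ) : ℝ) / π) ^ 2 ≤ (n : ℝ) ^ 2 := by
      gcongr
      rw [div_le_iff₀ Real.pi_pos]
      push_cast
      nlinarith [Real.pi_gt_three]
    calc 8 * (((n + 1 : ℕ) : ℝ) / π) ^ 2 / d ≤ 8 * (n : ℝ) ^ 2 / (√d * √d) := by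
          rw [hss]
          gcongr
      _ ≤ 4 * n / √d := by
          rw [div_le_div_iff₀ (by positivity) hs]
          have : 0 ≤ n * √(d : ℝ) * (√d - 4 * n) := by
            have := sub_nonneg.2 hlarge.le
            positivity
          nlinarith [mul_pos (mul_pos (zero_lt_one.trans_le hn') hs) hs]
end

section
/- Let σ = (σ₁,…,σ_N) be a tuple of unit-norm step functions in L²([0,1]) where σᵢ has nᵢ jumps, and suppose (1/N) Σᵢ nᵢ ≤ ε√d/4. Then (1/N) Σᵢ ‖σᵢ − σᵢ(d)‖²_{L²} ≤ ε, where σᵢ(d) is the orthogonal projection of σᵢ onto span(e_1,…,e_d) in the standard Fourier basis. -/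
open Real Set

/-- `σ` is a `{-1,1}`-valued step function on `[0,1]` with exactly `n` jumps. -/
def IsSpinStepPath (n : ℕ) (σ : ℝ → ℝ) : Prop :=
  (∀ t ∈ Set.Ico (0:ℝ) 1, σ t = 1 ∨ σ t = -1) ∧
  ∃ a : Fin (n + 2) → ℝ,
    a 0 = 0 ∧ a (Fin.last (n + 1)) = 1 ∧ StrictMono a ∧
    (∀ i : Fin (n + 1),
      ∀ t ∈ Set.Ico (a i.castSucc) (a i.succ), σ t = σ (a i.castSucc)) ∧
    (∀ i : Fin n, σ (a i.castSucc.castSucc) ≠ σ (a i.succ.castSucc))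

open MeasureTheory Filter Topology intervalIntegral

/-- Partial sums of Fourier coefficients, grouped into the sine-cosine pairs. -/
lemma sum_Icc_one_odd (c : ℕ → ℝ) (M : ℕ) :
    ∑ k ∈ Finset.Icc 1 (2 * M + 1), c k =
      c 1 + ∑ m ∈ Finset.range M, (c (2 * m + 2) + c (2 * m + 3)) := by
  induction M with
  | zero => simp
  | succ M ih =>
    rw [show 2 * (M + 1) + 1 = 2 * M + 1 + 1 + 1 by ring, Finset.sum_Icc_succ_top (by omega),
      Finset.sum_Icc_succ_top (by omega), ih, Finset.sum_range_succ]
    ring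

lemma sum_Ico_inv_sq_le {M K : ℕ} (hMK : M ≤ K) :
    ∑ m ∈ Finset.Ico M K, (1 : ℝ) / ((m : ℝ) + 1) ^ 2 ≤
      2 / (2 * (M : ℝ) + 1) - 2 / (2 * (K : ℝ) + 1) := by
  induction K, hMK using Nat.le_induction with
  | base => simp
  | succ K hK ih =>
    rw [Finset.sum_Ico_succ_top hK]
    have : 1 / ((K : ℝ) + 1) ^ 2 ≤ 2 / (2 * (K : ℝ) + 1) - 2 / (2 * ((K + 1 : ℕ) : ℝ) + 1) := by
      push_cast
      rw [div_sub_div _ _ (by positivity) (by positivity),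
        div_le_div_iff₀ (by positivity) (by positivity)]
      nlinarith
    linarith

namespace IsSpinStepPath

variable {n : ℕ} {σ : ℝ → ℝ}

/-- A step path with `n` jumps is constant on each of `n + 1` consecutive intervals. -/
lemma exists_partition (h : IsSpinStepPath n σ) :
    ∃ b : ℕ → ℝ, b 0 = 0 ∧ b (n + 1) = 1 ∧ ∀ k < n + 1, b k < b (k + 1) ∧ b k ∈ Ico (0 : ℝ) 1 ∧
      EqOn σ (fun _ ↦ σ (b k)) (Ioo (b k) (b (k + 1))) := by
  obtain ⟨-, a, ha0, ha1, hmono, hconst, -⟩ := h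
  refine ⟨fun k ↦ a ⟨min k (n + 1), by omega⟩, ?_, ?_, fun k hk ↦ ?_⟩
  · simpa using ha0
  · simpa [Fin.last] using ha1
  · have e1 : (⟨min k (n + 1), by omega⟩ : Fin (n + 2)) = (⟨k, hk⟩ : Fin (n + 1)).castSucc := by
      ext; simp; omega
    have e2 : (⟨min (k + 1) (n + 1), by omega⟩ : Fin (n + 2)) = (⟨k, hk⟩ : Fin (n + 1)).succ := by
      ext; simp; omega
    simp only [e1, e2]
    refine ⟨hmono Fin.castSucc_lt_succ, ⟨?_, ?_⟩, fun t ht ↦ hconst _ t ⟨ht.1.le, ht.2⟩⟩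
    · rw [← ha0]; exact hmono.monotone (Fin.zero_le _)
    · rw [← ha1]; exact hmono (Fin.castSucc_lt_last _)

lemma abs_eq_one (h : IsSpinStepPath n σ) {t : ℝ} (ht : t ∈ Ico (0 : ℝ) 1) : |σ t| = 1 := by
  rcases h.1 t ht with h | h <;> simp [h]

lemma intervalIntegrable (h : IsSpinStepPath n σ) : IntervalIntegrable σ volume 0 1 := by
  obtain ⟨b, hb0, hb1, hb⟩ := h.exists_partition
  rw [← hb0, ← hb1]
  refine IntervalIntegrable.trans_iterate fun k hk ↦ ?_
  obtain ⟨hlt, -, hc⟩ := hb k hk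
  refine (intervalIntegrable_const (c := σ (b k))).congr_uIoo ?_
  rw [uIoo_of_le hlt.le]
  exact hc.symm

lemma norm_integral_mul_le (h : IsSpinStepPath n σ) {g : ℝ → ℂ} (hg : Continuous g) {C : ℝ}
    (hC : ∀ x y, ‖∫ t in x..y, g t‖ ≤ C) : ‖∫ t in (0 : ℝ)..1, g t * σ t‖ ≤ (n + 1) * C := by
  obtain ⟨b, hb0, hb1, hb⟩ := h.exists_partition
  have hcongr : ∀ k < n + 1, EqOn (fun t ↦ g t * σ (b k)) (fun t ↦ g t * σ t)
      (Ioo (b k) (b (k + 1))) := fun k hk t ht ↦ by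
    have := (hb k hk).2.2 ht
    simp only at this ⊢
    rw [this]
  have hsum : ∑ k ∈ Finset.range (n + 1), ∫ t in b k..b (k + 1), g t * σ t =
      ∫ t in (0 : ℝ)..1, g t * σ t := by
    rw [← hb0, ← hb1]
    refine sum_integral_adjacent_intervals fun k hk ↦ ?_
    refine ((hg.mul (continuous_const (y := (σ (b k) : ℂ)))).intervalIntegrable _ _).congr_uIoo ?_
    rw [uIoo_of_le (hb k hk).1.le]
    exact hcongr k hk
  rw [← hsum]
  calc _ ≤ ∑ k ∈ Finset.range (n + 1), C := norm_sum_le_of_le _ fun k hk ↦ ?_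
    _ = _ := by simp
  have hk := Finset.mem_range.1 hk
  rw [← integral_congr_Ioo_of_le (hb k hk).1.le (hcongr k hk),
    intervalIntegral.integral_mul_const, norm_mul,
    Complex.norm_real, Real.norm_eq_abs, h.abs_eq_one (hb k hk).2.1, mul_one]
  exact hC _ _

lemma integral_sq (h : IsSpinStepPath n σ) : ∫ t in (0 : ℝ)..1, σ t ^ 2 = 1 := by
  rw [integral_congr_Ioo_of_le zero_le_one (g := fun _ ↦ 1) fun t ht ↦ ?_]
  · simp
  · simp [← sq_abs (σ t), h.abs_eq_one ⟨ht.1.le, ht.2⟩]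

lemma memLp (h : IsSpinStepPath n σ) :
    MemLp (fun t ↦ (σ t : ℂ)) 2 (volume.restrict (Ioc 0 1)) := by
  have hm : AEStronglyMeasurable (fun t ↦ (σ t : ℂ)) (volume.restrict (Ioc 0 1)) :=
    Complex.continuous_ofReal.comp_aestronglyMeasurable h.intervalIntegrable.1.1
  refine MemLp.of_bound hm 1 ?_
  rw [← restrict_Ioo_eq_restrict_Ioc]
  refine ae_restrict_of_forall_mem measurableSet_Ioo fun t ht ↦ ?_
  simp [h.abs_eq_one ⟨ht.1.le, ht.2⟩]

lemma fourierCoeffOn_eq (m : ℤ) :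
    fourierCoeffOn zero_lt_one (fun t ↦ (σ t : ℂ)) m =
      ∫ t in (0 : ℝ)..1, Complex.exp ((-(2 * π * m) * Complex.I) * t) * σ t := by
  rw [fourierCoeffOn_eq_integral]
  simp only [sub_zero, ne_eq, one_ne_zero, not_false_eq_true, div_self, one_smul]
  refine integral_congr fun t _ ↦ ?_
  simp only [smul_eq_mul]
  rw [fourier_coe_apply]
  congr 2
  push_cast
  ring

lemma norm_fourierCoeffOn_le (h : IsSpinStepPath n σ) {m : ℤ} (hm : m ≠ 0) :
    ‖fourierCoeffOn zero_lt_one (fun t ↦ (σ t : ℂ)) m‖ ≤ (n + 1) / (π * |m|) := by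
  rw [fourierCoeffOn_eq, div_eq_mul_one_div]
  have hc : (-(2 * π * m) * Complex.I : ℂ) ≠ 0 := by
    simp [hm, Real.pi_ne_zero]
  refine h.norm_integral_mul_le (by fun_prop) fun x y ↦ ?_
  have hexp (x : ℝ) : ‖Complex.exp ((-(2 * π * m) * Complex.I) * x)‖ = 1 := by
    rw [← Complex.norm_exp_ofReal_mul_I (-(2 * π * m) * x)]
    congr 2
    push_cast
    ring
  rw [integral_exp_mul_complex hc, norm_div]
  have hnorm : ‖(-(2 * π * m) * Complex.I : ℂ)‖ = 2 * (π * |(m : ℝ)|) := by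
    simp [abs_of_pos Real.pi_pos, mul_assoc]
  have hpos : 0 < π * |(m : ℝ)| := by positivity
  rw [hnorm, div_le_div_iff₀ (by positivity) (by exact_mod_cast hpos)]
  have := norm_sub_le (Complex.exp ((-(2 * π * m) * Complex.I) * y))
    (Complex.exp ((-(2 * π * m) * Complex.I) * x))
  rw [hexp, hexp] at this
  push_cast
  nlinarith

lemma norm_fourierCoeffOn_sq (h : IsSpinStepPath n σ) (m : ℤ) :
    ‖fourierCoeffOn zero_lt_one (fun t ↦ (σ t : ℂ)) m‖ ^ 2 =
      (∫ t in (0 : ℝ)..1, Real.cos (2 * π * m * t) * σ t) ^ 2 +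
      (∫ t in (0 : ℝ)..1, Real.sin (2 * π * m * t) * σ t) ^ 2 := by
  have hcos : IntervalIntegrable (fun t ↦ Real.cos (2 * π * m * t) * σ t) volume 0 1 :=
    h.intervalIntegrable.continuousOn_mul (by fun_prop)
  have hsin : IntervalIntegrable (fun t ↦ Real.sin (2 * π * m * t) * σ t) volume 0 1 :=
    h.intervalIntegrable.continuousOn_mul (by fun_prop)
  have hcosC : IntervalIntegrable (fun t ↦ ((Real.cos (2 * π * m * t) * σ t : ℝ) : ℂ)) volume 0 1 :=
    ⟨hcos.1.ofReal, hcos.2.ofReal⟩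
  have hsinC : IntervalIntegrable (fun t ↦ ((-(Real.sin (2 * π * m * t) * σ t) : ℝ) : ℂ))
      volume 0 1 := ⟨hsin.neg.1.ofReal, hsin.neg.2.ofReal⟩
  have key : fourierCoeffOn zero_lt_one (fun t ↦ (σ t : ℂ)) m =
      (∫ t in (0 : ℝ)..1, Real.cos (2 * π * m * t) * σ t : ℝ) +
      (-∫ t in (0 : ℝ)..1, Real.sin (2 * π * m * t) * σ t : ℝ) * Complex.I := by
    rw [fourierCoeffOn_eq, ← intervalIntegral.integral_neg, ← intervalIntegral.integral_ofReal,
      ← intervalIntegral.integral_ofReal, ← intervalIntegral.integral_mul_const,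
      ← intervalIntegral.integral_add hcosC (hsinC.mul_const Complex.I)]
    refine integral_congr fun t _ ↦ ?_
    have harg : (-(2 * π * m) * Complex.I : ℂ) * t = ((-(2 * π * m * t) : ℝ) : ℂ) * Complex.I := by
      push_cast; ring
    simp only [harg, Complex.exp_mul_I, ← Complex.ofReal_cos, ← Complex.ofReal_sin, Real.cos_neg,
      Real.sin_neg]
    push_cast
    ring
  rw [key, ← Complex.normSq_eq_norm_sq, Complex.normSq_add_mul_I, neg_sq]

lemma norm_fourierCoeffOn_neg (h : IsSpinStepPath n σ) (m : ℤ) :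
    ‖fourierCoeffOn zero_lt_one (fun t ↦ (σ t : ℂ)) (-m)‖ ^ 2 =
      ‖fourierCoeffOn zero_lt_one (fun t ↦ (σ t : ℂ)) m‖ ^ 2 := by
  simp [h.norm_fourierCoeffOn_sq]

lemma fourierE_sq_add_sq (h : IsSpinStepPath n σ) (m : ℕ) :
    (∫ t in (0 : ℝ)..1, fourierE (2 * m + 2) t * σ t) ^ 2 +
      (∫ t in (0 : ℝ)..1, fourierE (2 * m + 3) t * σ t) ^ 2 =
    2 * ‖fourierCoeffOn zero_lt_one (fun t ↦ (σ t : ℂ)) (m + 1 : ℕ)‖ ^ 2 := by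
  have h2 : ∀ t, fourierE (2 * m + 2) t = √2 * Real.sin (2 * π * ((m + 1 : ℕ) : ℤ) * t) := by
    intro t
    have : (2 * m + 2) / 2 = m + 1 := by omega
    simp [fourierE, this]
  have h3 : ∀ t, fourierE (2 * m + 3) t = √2 * Real.cos (2 * π * ((m + 1 : ℕ) : ℤ) * t) := by
    intro t
    have : (2 * m + 3) / 2 = m + 1 := by omega
    have h' : (2 * m + 3) % 2 = 1 := by omega
    simp [fourierE, this, h']
  simp only [h2, h3, mul_assoc (√2), intervalIntegral.integral_const_mul, mul_pow,
    h.norm_fourierCoeffOn_sq]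
  norm_num
  ring

lemma hasSum_fourierE_pairs (h : IsSpinStepPath n σ) :
    HasSum (fun m : ℕ ↦ (∫ t in (0 : ℝ)..1, fourierE (2 * m + 2) t * σ t) ^ 2 +
      (∫ t in (0 : ℝ)..1, fourierE (2 * m + 3) t * σ t) ^ 2)
      (1 - (∫ t in (0 : ℝ)..1, fourierE 1 t * σ t) ^ 2) := by
  have hp := (hasSum_sq_fourierCoeffOn zero_lt_one h.memLp).nat_add_neg
  have h0 : ‖fourierCoeffOn zero_lt_one (fun t ↦ (σ t : ℂ)) 0‖ ^ 2 =
      (∫ t in (0 : ℝ)..1, fourierE 1 t * σ t) ^ 2 := by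
    simp [h.norm_fourierCoeffOn_sq, fourierE]
  have hI : (1 - 0 : ℝ)⁻¹ • ∫ t in (0 : ℝ)..1, ‖(σ t : ℂ)‖ ^ 2 = 1 := by
    simpa using h.integral_sq
  rw [hI, ← hasSum_nat_add_iff' 1] at hp
  simp_rw [h.norm_fourierCoeffOn_neg] at hp
  simp_rw [h.fourierE_sq_add_sq, two_mul]
  convert! hp using 1
  simp only [Finset.sum_range_one, Nat.cast_zero, h0]
  ring

lemma one_sub_sum_le_of_odd (h : IsSpinStepPath n σ) (M : ℕ) :
    1 - ∑ k ∈ Finset.Icc 1 (2 * M + 1), (∫ t in (0 : ℝ)..1, fourierE k t * σ t) ^ 2 ≤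
      2 * ((n + 1) / π) ^ 2 * (2 / (2 * M + 1)) := by
  rw [sum_Icc_one_odd (fun k ↦ (∫ t in (0 : ℝ)..1, fourierE k t * σ t) ^ 2), ← sub_sub]
  refine le_of_tendsto (h.hasSum_fourierE_pairs.tendsto_sum_nat.sub_const _)
    (eventually_atTop.2 ⟨M, fun K hK ↦ ?_⟩)
  rw [← Finset.sum_Ico_eq_sub _ hK]
  calc _ ≤ ∑ m ∈ Finset.Ico M K, 2 * ((n + 1) / π) ^ 2 * (1 / ((m : ℝ) + 1) ^ 2) := by
        refine Finset.sum_le_sum fun m _ ↦ ?_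
        rw [h.fourierE_sq_add_sq, mul_assoc]
        gcongr
        refine (pow_le_pow_left₀ (norm_nonneg _)
          (h.norm_fourierCoeffOn_le (Nat.cast_ne_zero.2 m.succ_ne_zero)) 2).trans_eq ?_
        have hm : ((|((m.succ : ℕ) : ℤ)| : ℤ) : ℝ) = m + 1 := by
          simp [abs_of_pos, m.cast_add_one_pos]
        rw [hm]
        field_simp
    _ ≤ _ := by
        rw [← Finset.mul_sum]
        gcongr
        have : (0 : ℝ) ≤ 2 / (2 * K + 1) := by positivity
        linarith [sum_Ico_inv_sq_le hK]

/-- The squared distance of a step path with `n` jumps to the span of the first `d` Fourier modes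
is at most `4 n / √d`. -/
lemma one_sub_sum_le (h : IsSpinStepPath n σ) {d : ℕ} (hd : 1 ≤ d) :
    1 - ∑ k ∈ Finset.Icc 1 d, (∫ t in (0 : ℝ)..1, fourierE k t * σ t) ^ 2 ≤ 4 * n / √d := by
  set T := 1 - ∑ k ∈ Finset.Icc 1 d, (∫ t in (0 : ℝ)..1, fourierE k t * σ t) ^ 2
  have hd' : (1 : ℝ) ≤ d := by exact_mod_cast hd
  have hT1 : T ≤ 1 := sub_le_self _ (Finset.sum_nonneg fun _ _ ↦ sq_nonneg _)
  rcases Nat.eq_zero_or_pos n with rfl | hn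
  · obtain ⟨b, hb0, hb1, hb⟩ := h.exists_partition
    obtain ⟨-, hmem, hc⟩ := hb 0 one_pos
    rw [zero_add] at hb1 hc
    have hone : (∫ t in (0 : ℝ)..1, fourierE 1 t * σ t) ^ 2 = 1 := by
      rw [integral_congr_Ioo_of_le zero_le_one (g := fun _ ↦ σ (b 0)) fun t ht ↦ ?_]
      · simp [← sq_abs (σ (b 0)), h.abs_eq_one hmem]
      · simpa [fourierE] using hc (hb0 ▸ hb1 ▸ ht)
    have := Finset.single_le_sum (f := fun k ↦ (∫ t in (0 : ℝ)..1, fourierE k t * σ t) ^ 2)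
      (fun _ _ ↦ sq_nonneg _) (Finset.mem_Icc.2 ⟨le_rfl, hd⟩)
    simp only [hone] at this
    simp only [CharP.cast_eq_zero, mul_zero, zero_div]
    linarith
  · have hn' : (1 : ℝ) ≤ n := by exact_mod_cast hn
    have hTd : T ≤ (4 * n) ^ 2 / d := by
      set M := (d - 1) / 2
      have hMd : 2 * M + 1 ≤ d := by omega
      have hdM : (d : ℝ) ≤ 2 * (2 * M + 1) := by
        exact_mod_cast (show d ≤ 2 * (2 * M + 1) by omega)
      calc T ≤ _ := sub_le_sub_left (Finset.sum_le_sum_of_subset_of_nonneg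
            (Finset.Icc_subset_Icc_right hMd) fun _ _ _ ↦ sq_nonneg _) _
        _ ≤ _ := h.one_sub_sum_le_of_odd M
        _ ≤ 2 * (2 * n / 3) ^ 2 * (4 / d) := by
            gcongr ?_ * ?_
            · have : (n + 1) / π ≤ 2 * n / 3 := by
                gcongr
                · linarith
                · exact Real.pi_gt_three.le
              gcongr
            · rw [div_le_div_iff₀ (by positivity) (by positivity)]
              linarith
        _ ≤ _ := by
            rw [mul_div_assoc']
            gcongr
            nlinarith
    rcases le_total 1 (4 * n / √d) with h1 | h1
    · exact hT1.trans h1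
    · refine hTd.trans ?_
      rw [show (4 * n : ℝ) ^ 2 / d = (4 * n / √d) ^ 2 by
        rw [div_pow, Real.sq_sqrt (by positivity)]]
      nlinarith [show (0 : ℝ) ≤ 4 * n / √d by positivity]

end IsSpinStepPath

/-- If `σ₁, …, σ_N` are unit-norm spin step paths where `σᵢ` has `nᵢ`
jumps and the average number of jumps satisfies `(1/N)∑ᵢ nᵢ ≤ ε√d/4`, then the
average squared projection error onto the span of the first `d` Fourier modes is
at most `ε`. Here `‖σᵢ - σᵢ(d)‖² = ∫₀¹ σᵢ(t)² dt - ∑_{k=1}^d ⟨e_k, σᵢ⟩²` by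
Parseval. -/
theorem average_projection_error_bound
    (N : ℕ) (hN : 1 ≤ N) (σ : Fin N → ℝ → ℝ) (nflips : Fin N → ℕ)
    (hstep : ∀ i, IsSpinStepPath (nflips i) (σ i))
    (d : ℕ) (hd : 1 ≤ d) (ε : ℝ)
    (hflips : (1 / (N : ℝ)) * ∑ i, (nflips i : ℝ) ≤ ε * Real.sqrt d / 4) :
    (1 / (N : ℝ)) * ∑ i, ((∫ t in (0:ℝ)..1, (σ i t) ^ 2)
        - ∑ k ∈ Finset.Icc 1 d, (∫ t in (0:ℝ)..1, fourierE k t * σ i t) ^ 2)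
      ≤ ε := by
  have hs : (0 : ℝ) < √d := Real.sqrt_pos.2 (by exact_mod_cast hd)
  calc _ ≤ (1 / (N : ℝ)) * ∑ i, 4 * (nflips i : ℝ) / √d := by
        gcongr with i
        rw [(hstep i).integral_sq]
        exact (hstep i).one_sub_sum_le hd
    _ = (1 / (N : ℝ) * ∑ i, (nflips i : ℝ)) * (4 / √d) := by
        rw [mul_assoc, Finset.sum_mul]
        simp only [mul_div_assoc, mul_comm]
    _ ≤ ε * √d / 4 * (4 / √d) := by gcongr
    _ = ε := by field_simp
end

section
/- Let X, Y be two independent centered Gaussian vectors indexed by a finite set S, and for t ∈ [0,1] set Z_t(σ) = √t·X(σ) + √(1−t)·Y(σ). Suppose |Cov(X(σ),X(τ)) − Cov(Y(σ),Y(τ))| ≤ δ for all σ, τ ∈ S. Then for any probability measure μ on S, |E log Σ_σ μ(σ)e^{X(σ)} − E log Σ_σ μ(σ)e^{Y(σ)}| ≤ δ. -/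
open MeasureTheory ProbabilityTheory Real

lemma hasDerivAt_gaussianPDFReal_zero {v : NNReal} (hv : v ≠ 0) (x : ℝ) :
    HasDerivAt (gaussianPDFReal 0 v) (-(x / v) * gaussianPDFReal 0 v x) x := by
  have hv' : (v : ℝ) ≠ 0 := by exact_mod_cast hv
  have h : HasDerivAt (fun y : ℝ => -(y - 0) ^ 2 / (2 * v)) (-(x / v)) x := by
    refine ((((hasDerivAt_id x).sub_const 0).pow 2).neg.div_const (2 * (v : ℝ))).congr_deriv ?_
    simp
    field_simp
  rw [gaussianPDFReal_def]
  refine (h.exp.const_mul (√(2 * π * v))⁻¹).congr_deriv ?_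
  ring

/-- **Stein's lemma** for a centered real Gaussian measure. -/
lemma integral_mul_gaussianReal_eq_integral_deriv (v : NNReal) {g g' : ℝ → ℝ} {C C' : ℝ}
    (hg : ∀ x, HasDerivAt g (g' x) x) (hg'm : Measurable g')
    (hgC : ∀ x, |g x| ≤ C) (hg'C : ∀ x, |g' x| ≤ C') :
    ∫ x, x * g x ∂gaussianReal 0 v = v * ∫ x, g' x ∂gaussianReal 0 v := by
  rcases eq_or_ne v 0 with rfl | hv
  · simp
  have hv' : (v : ℝ) ≠ 0 := by exact_mod_cast hv
  have hvpos : (0 : ℝ) < v := by positivity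
  have hgm : Measurable g :=
    (continuous_iff_continuousAt.2 fun x => (hg x).continuousAt).measurable
  have hp := integrable_gaussianPDFReal 0 v
  have hxp : Integrable fun x => -(x / v) * gaussianPDFReal 0 v x := by
    have := (integrable_mul_exp_neg_mul_sq (b := 1 / (2 * v)) (by positivity)).const_mul
      (-(v : ℝ)⁻¹ * (√(2 * π * v))⁻¹)
    refine this.congr (.of_forall fun x => ?_)
    have : -(1 / (2 * (v : ℝ))) * x ^ 2 = -(x - 0) ^ 2 / (2 * v) := by field_simp; ring
    simp only [gaussianPDFReal_def, this]
    ring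
  have key := integral_mul_deriv_eq_deriv_mul_of_integrable (u := g) (u' := g')
    (v := gaussianPDFReal 0 v) (fun x _ => hg x)
    (fun x _ => hasDerivAt_gaussianPDFReal_zero hv x)
    (hxp.bdd_mul hgm.aestronglyMeasurable (.of_forall fun x => by simpa using hgC x))
    (hp.bdd_mul hg'm.aestronglyMeasurable (.of_forall fun x => by simpa using hg'C x))
    (hp.bdd_mul hgm.aestronglyMeasurable (.of_forall fun x => by simpa using hgC x))
  rw [integral_gaussianReal_eq_integral_smul hv, integral_gaussianReal_eq_integral_smul hv]
  have h1 : ∫ x, gaussianPDFReal 0 v x • (x * g x) =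
      -v * ∫ x, g x * (-(x / v) * gaussianPDFReal 0 v x) := by
    rw [← integral_const_mul]
    congr with x
    simp only [smul_eq_mul]
    field_simp
  rw [h1, key]
  simp only [smul_eq_mul, mul_comm (g' _)]
  ring

/-- **Gaussian integration by parts**: if `(W, Z)` is jointly Gaussian and `W` is centered, then
`E[W f(Z)]` is the expectation of the derivative of `f` at `Z` in the direction `Cov(W, Z)`. -/
lemma ProbabilityTheory.HasGaussianLaw.integral_mul_comp_eq_integral_lineDeriv
    {Ω S : Type*} [Fintype S] [MeasurableSpace Ω] {P : Measure Ω}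
    {W : Ω → ℝ} {Z : S → Ω → ℝ} (hWZ : HasGaussianLaw (fun ω => (W ω, fun σ => Z σ ω)) P)
    (hW : ∫ ω, W ω ∂P = 0) {f f' : (S → ℝ) → ℝ} {C C' : ℝ}
    (hf : ∀ z, HasLineDerivAt ℝ f (f' z) z (fun σ => cov[W, Z σ; P]))
    (hfm : Measurable f) (hf'm : Measurable f')
    (hfC : ∀ z, |f z| ≤ C) (hf'C : ∀ z, |f' z| ≤ C') :
    ∫ ω, W ω * f (fun σ => Z σ ω) ∂P = ∫ ω, f' (fun σ => Z σ ω) ∂P := by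
  have hP := hWZ.isProbabilityMeasure
  have hWm : AEMeasurable W P := hWZ.fst.aemeasurable
  have hZ2 : ∀ σ, MemLp (Z σ) 2 P := fun σ => (hWZ.snd.eval σ).memLp_two
  have hW2 : MemLp W 2 P := hWZ.fst.memLp_two
  set c : S → ℝ := fun σ => cov[W, Z σ; P] with hc
  have hlaw : P.map W = gaussianReal 0 Var[W; P].toNNReal := by
    rw [hWZ.fst.map_eq_gaussianReal, hW]
  rcases eq_or_ne Var[W; P] 0 with hV | hV
  · have hW0 : W =ᵐ[P] 0 := by
      have h := hlaw
      rw [hV, toNNReal_zero, gaussianReal_zero_var] at h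
      have : ∀ᵐ x ∂P.map W, x = 0 := by rw [h]; simp
      exact ae_of_ae_map hWm this
    have hc0 : c = 0 := by
      ext σ
      change cov[W, Z σ; P] = 0
      rw [covariance_eq_sub hW2 (hZ2 σ), hW, zero_mul, sub_zero,
        integral_congr_ae (g := 0) (by filter_upwards [hW0] with ω h; simp [h])]
      simp
    have hf'0 : ∀ z, f' z = 0 := fun z => by
      have := hf z
      rw [hc0] at this
      exact this.unique hasLineDerivAt_zero
    rw [integral_congr_ae (g := 0) (by filter_upwards [hW0] with ω h; simp [h])]
    simp [hf'0]
  set V := Var[W; P] with hVdef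
  have hV0 : 0 ≤ V := variance_nonneg _ _
  set a : S → ℝ := V⁻¹ • c with ha
  set R : S → Ω → ℝ := fun σ ω => Z σ ω - a σ * W ω with hR
  have hRW : HasGaussianLaw (fun ω => (fun σ => R σ ω, fun _ : Unit => W ω)) P := by
    let L : ℝ × (S → ℝ) →L[ℝ] (S → ℝ) × (Unit → ℝ) :=
      (ContinuousLinearMap.snd ℝ ℝ (S → ℝ) -
        (ContinuousLinearMap.fst ℝ ℝ (S → ℝ)).smulRight a).prod
        (ContinuousLinearMap.pi fun _ => ContinuousLinearMap.fst ℝ ℝ (S → ℝ))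
    have hL : (fun ω => (fun σ => R σ ω, fun _ : Unit => W ω)) =
        fun ω => L (W ω, fun σ => Z σ ω) := by
      ext ω σ <;> simp [L, hR, mul_comm]
    rw [hL]
    exact hWZ.map_fun L
  have hind : IndepFun (fun ω σ => R σ ω) W P := by
    have := hRW.indepFun_of_covariance_eval (X := R) (Y := fun _ => W) fun σ _ => by
      rw [hR, covariance_fun_sub_left (hZ2 σ) (hW2.const_mul _) hW2, covariance_const_mul_left,
        covariance_self hWm, ha, covariance_comm]
      simp only [Pi.smul_apply, smul_eq_mul, hc]
      rw [← hVdef, mul_right_comm, inv_mul_cancel₀ hV, one_mul, sub_self]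
    exact this.comp measurable_id (measurable_pi_apply ())
  have hRm : AEMeasurable (fun ω σ => R σ ω) P := hRW.fst.aemeasurable
  have hprod := (indepFun_iff_map_prod_eq_prod_map_map hRm hWm).1 hind
  have hZR : ∀ ω, (fun σ => Z σ ω) = (fun σ => R σ ω) + W ω • a := fun ω => by
    ext σ; simp [hR, mul_comm]
  have hWint : Integrable W P := hWZ.fst.integrable
  have := Measure.isProbabilityMeasure_map (μ := P) hRm
  have := Measure.isProbabilityMeasure_map (μ := P) hWm
  have hmeas : Measurable fun p : (S → ℝ) × ℝ => p.1 + p.2 • a := by fun_prop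
  have fubini : ∀ {F : (S → ℝ) × ℝ → ℝ}, Measurable F →
      Integrable (fun ω => F (fun σ => R σ ω, W ω)) P →
      ∫ ω, F (fun σ => R σ ω, W ω) ∂P =
        ∫ r, ∫ x, F (r, x) ∂gaussianReal 0 V.toNNReal ∂P.map (fun ω σ => R σ ω) := by
    intro F hF hFi
    rw [← integral_map (φ := fun ω => (fun σ => R σ ω, W ω)) (hRm.prodMk hWm)
      hF.aestronglyMeasurable, hprod, integral_prod, hlaw]
    rw [← hprod]
    exact (integrable_map_measure hF.aestronglyMeasurable (hRm.prodMk hWm)).2 hFi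
  simp_rw [hZR]
  rw [fubini (F := fun p => p.2 * f (p.1 + p.2 • a)), fubini (F := fun p => f' (p.1 + p.2 • a))]
  · congr with r
    rw [integral_mul_gaussianReal_eq_integral_deriv V.toNNReal (g := fun x => f (r + x • a))
      (g' := fun x => V⁻¹ * f' (r + x • a)) (C := C) (C' := V⁻¹ * C'), integral_const_mul,
      Real.coe_toNNReal _ hV0, mul_inv_cancel_left₀ hV]
    · intro x
      have h := (hf (r + x • a)).smul V⁻¹
      rw [HasLineDerivAt, ← sub_self x] at h
      have hg : (fun y => f (r + y • a)) = fun y => f (r + x • a + (y - x) • V⁻¹ • c) := by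
        ext y
        rw [← ha]
        congr 1
        module
      rw [hg]
      exact h.comp_sub_const x x
    · fun_prop
    · exact fun x => hfC _
    · intro x
      rw [abs_mul, abs_of_nonneg (inv_nonneg.2 hV0)]
      gcongr
      exact hf'C _
  · exact hf'm.comp hmeas
  · exact .of_bound ((hf'm.comp hmeas).comp_aemeasurable (hRm.prodMk hWm)).aestronglyMeasurable C'
      (.of_forall fun ω => hf'C _)
  · exact measurable_snd.mul (hfm.comp hmeas)
  · exact hWint.mul_bdd (c := C)
      ((hfm.comp hmeas).comp_aemeasurable (hRm.prodMk hWm)).aestronglyMeasurable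
      (.of_forall fun ω => hfC _)

section Gibbs

variable {S : Type*} [Fintype S]

/-- The Gibbs probability of the state `σ` for the reference weights `w` and the energy `z`. -/
noncomputable def gibbsWeight (w z : S → ℝ) (σ : S) : ℝ :=
  w σ * exp (z σ) / ∑ τ, w τ * exp (z τ)

variable {w : S → ℝ}

lemma sum_mul_exp_pos (hw : ∀ σ, 0 ≤ w σ) (hw1 : ∑ σ, w σ = 1) (z : S → ℝ) :
    0 < ∑ σ, w σ * exp (z σ) := by
  obtain ⟨σ, -, hσ⟩ := Finset.exists_ne_zero_of_sum_ne_zero (hw1.trans_ne one_ne_zero)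
  exact Finset.sum_pos' (fun τ _ => mul_nonneg (hw τ) (exp_pos _).le)
    ⟨σ, Finset.mem_univ σ, mul_pos (lt_of_le_of_ne' (hw σ) hσ) (exp_pos _)⟩

lemma gibbsWeight_nonneg (hw : ∀ σ, 0 ≤ w σ) (z : S → ℝ) (σ : S) : 0 ≤ gibbsWeight w z σ :=
  div_nonneg (mul_nonneg (hw σ) (exp_pos _).le)
    (Finset.sum_nonneg fun τ _ => mul_nonneg (hw τ) (exp_pos _).le)

lemma sum_gibbsWeight (hw : ∀ σ, 0 ≤ w σ) (hw1 : ∑ σ, w σ = 1) (z : S → ℝ) :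
    ∑ σ, gibbsWeight w z σ = 1 := by
  simp only [gibbsWeight]
  rw [← Finset.sum_div, div_self (sum_mul_exp_pos hw hw1 z).ne']

lemma gibbsWeight_le_one (hw : ∀ σ, 0 ≤ w σ) (hw1 : ∑ σ, w σ = 1) (z : S → ℝ) (σ : S) :
    gibbsWeight w z σ ≤ 1 := by
  rw [← sum_gibbsWeight hw hw1 z]
  exact Finset.single_le_sum (fun τ _ => gibbsWeight_nonneg hw z τ) (Finset.mem_univ σ)

@[fun_prop]
lemma measurable_gibbsWeight (w : S → ℝ) (σ : S) : Measurable fun z => gibbsWeight w z σ := by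
  unfold gibbsWeight
  fun_prop

/-- A Gibbs average is bounded by any bound on the averaged function. -/
lemma abs_sum_gibbsWeight_mul_le (hw : ∀ σ, 0 ≤ w σ) (hw1 : ∑ σ, w σ = 1) (z : S → ℝ)
    {c : S → ℝ} {M : ℝ} (hc : ∀ σ, |c σ| ≤ M) : |∑ σ, gibbsWeight w z σ * c σ| ≤ M := by
  calc |∑ σ, gibbsWeight w z σ * c σ|
      ≤ ∑ σ, gibbsWeight w z σ * M := by
        refine (Finset.abs_sum_le_sum_abs _ _).trans (Finset.sum_le_sum fun σ _ => ?_)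
        rw [abs_mul, abs_of_nonneg (gibbsWeight_nonneg hw z σ)]
        exact mul_le_mul_of_nonneg_left (hc σ) (gibbsWeight_nonneg hw z σ)
    _ = M := by rw [← Finset.sum_mul, sum_gibbsWeight hw hw1, one_mul]

lemma abs_log_sum_mul_exp_le (hw : ∀ σ, 0 ≤ w σ) (hw1 : ∑ σ, w σ = 1) (z : S → ℝ) :
    |log (∑ σ, w σ * exp (z σ))| ≤ ∑ σ, |z σ| := by
  have hz : ∀ σ, |z σ| ≤ ∑ τ, |z τ| := fun σ =>
    Finset.single_le_sum (fun τ _ => abs_nonneg (z τ)) (Finset.mem_univ σ)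
  have hpos := sum_mul_exp_pos hw hw1 z
  rw [abs_le]
  constructor
  · rw [le_log_iff_exp_le hpos]
    calc exp (-∑ τ, |z τ|) = ∑ σ, w σ * exp (-∑ τ, |z τ|) := by
          rw [← Finset.sum_mul, hw1, one_mul]
      _ ≤ _ := Finset.sum_le_sum fun σ _ => mul_le_mul_of_nonneg_left
          (exp_le_exp.2 (abs_le.1 (hz σ)).1) (hw σ)
  · rw [log_le_iff_le_exp hpos]
    calc ∑ σ, w σ * exp (z σ) ≤ ∑ σ, w σ * exp (∑ τ, |z τ|) :=
          Finset.sum_le_sum fun σ _ => mul_le_mul_of_nonneg_left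
            (exp_le_exp.2 (abs_le.1 (hz σ)).2) (hw σ)
      _ = exp (∑ τ, |z τ|) := by rw [← Finset.sum_mul, hw1, one_mul]

lemma hasDerivAt_sum_mul_exp {z : ℝ → S → ℝ} {z' : S → ℝ} {t : ℝ} (w : S → ℝ)
    (hz : ∀ σ, HasDerivAt (fun s => z s σ) (z' σ) t) :
    HasDerivAt (fun s => ∑ σ, w σ * exp (z s σ)) (∑ σ, w σ * exp (z t σ) * z' σ) t := by
  simp only [mul_assoc]
  exact HasDerivAt.fun_sum fun σ _ => (hz σ).exp.const_mul (w σ)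

lemma hasDerivAt_log_sum_mul_exp (hw : ∀ σ, 0 ≤ w σ) (hw1 : ∑ σ, w σ = 1)
    {z : ℝ → S → ℝ} {z' : S → ℝ} {t : ℝ} (hz : ∀ σ, HasDerivAt (fun s => z s σ) (z' σ) t) :
    HasDerivAt (fun s => log (∑ σ, w σ * exp (z s σ)))
      (∑ σ, gibbsWeight w (z t) σ * z' σ) t := by
  refine ((hasDerivAt_sum_mul_exp w hz).log (sum_mul_exp_pos hw hw1 _).ne').congr_deriv ?_
  simp only [gibbsWeight, Finset.sum_div, div_mul_eq_mul_div]

lemma hasDerivAt_gibbsWeight (hw : ∀ σ, 0 ≤ w σ) (hw1 : ∑ σ, w σ = 1)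
    {z : ℝ → S → ℝ} {z' : S → ℝ} {t : ℝ} (hz : ∀ σ, HasDerivAt (fun s => z s σ) (z' σ) t)
    (σ : S) :
    HasDerivAt (fun s => gibbsWeight w (z s) σ)
      (gibbsWeight w (z t) σ * (z' σ - ∑ τ, gibbsWeight w (z t) τ * z' τ)) t := by
  have hne := (sum_mul_exp_pos hw hw1 (z t)).ne'
  refine (((hz σ).exp.const_mul (w σ)).div (hasDerivAt_sum_mul_exp w hz) hne).congr_deriv ?_
  simp only [gibbsWeight, div_mul_eq_mul_div, ← Finset.sum_div]
  field_simp

end Gibbs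

/-- Two families of random variables are jointly Gaussian if all their linear combinations are. -/
lemma hasGaussianLaw_prodMk_of_forall_sum {S Ω : Type*} [Fintype S] [MeasurableSpace Ω]
    {μ : Measure Ω} {X Y : S → Ω → ℝ} (hmX : ∀ σ, Measurable (X σ)) (hmY : ∀ σ, Measurable (Y σ))
    (h : ∀ c c' : S → ℝ, ∃ (m : ℝ) (u : NNReal),
      Measure.map (fun ω => ∑ σ, (c σ * X σ ω + c' σ * Y σ ω)) μ = gaussianReal m u) :
    HasGaussianLaw (fun ω => (fun σ => X σ ω, fun σ => Y σ ω)) μ where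
  isGaussian_map := by
    classical
    refine isGaussian_of_map_eq_gaussianReal fun L => ?_
    obtain ⟨m, u, hu⟩ :=
      h (fun σ => L (Pi.single σ 1, 0)) (fun σ => L (0, Pi.single σ 1))
    refine ⟨m, u, ?_⟩
    rw [Measure.map_map (by fun_prop) (by fun_prop), ← hu]
    congr 1
    ext ω
    have h1 : ∀ p : (S → ℝ) × (S → ℝ), p =
        ∑ σ, (p.1 σ • ((Pi.single σ 1 : S → ℝ), (0 : S → ℝ)) +
          p.2 σ • ((0 : S → ℝ), (Pi.single σ 1 : S → ℝ))) := by
      intro p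
      ext τ <;> simp [Prod.fst_sum, Prod.snd_sum, Finset.sum_apply, Pi.single_apply]
    rw [Function.comp_apply, h1 (fun σ => X σ ω, fun σ => Y σ ω), map_sum]
    simp only [map_add, map_smul, smul_eq_mul, mul_comm]

/-- The derivative of the free energy along a rotation from `X` to `Y`. -/
lemma hasDerivAt_integral_log_sum_mul_exp_rotation {S Ω : Type*} [Fintype S] [MeasurableSpace Ω]
    {μ : Measure Ω} {X Y : S → Ω → ℝ} (hX : ∀ σ, Integrable (X σ) μ) (hY : ∀ σ, Integrable (Y σ) μ)
    {w : S → ℝ} (hw : ∀ σ, 0 ≤ w σ) (hw1 : ∑ σ, w σ = 1) (θ : ℝ) :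
    HasDerivAt
      (fun t => ∫ ω, log (∑ σ, w σ * exp (cos t * X σ ω + sin t * Y σ ω)) ∂μ)
      (∫ ω, ∑ σ, gibbsWeight w (fun τ => cos θ * X τ ω + sin θ * Y τ ω) σ *
        (-sin θ * X σ ω + cos θ * Y σ ω) ∂μ) θ := by
  have hXm : ∀ σ, AEMeasurable (X σ) μ := fun σ => (hX σ).aemeasurable
  have hYm : ∀ σ, AEMeasurable (Y σ) μ := fun σ => (hY σ).aemeasurable
  have hle : ∀ a b x y : ℝ, |a| ≤ 1 → |b| ≤ 1 → |a * x + b * y| ≤ |x| + |y| := by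
    intro a b x y ha hb
    refine (abs_add_le _ _).trans ?_
    rw [abs_mul, abs_mul]
    exact add_le_add (mul_le_of_le_one_left (abs_nonneg _) ha)
      (mul_le_of_le_one_left (abs_nonneg _) hb)
  have hbound : Integrable (fun ω => ∑ σ, (|X σ ω| + |Y σ ω|)) μ :=
    integrable_finsetSum _ fun σ _ => (hX σ).abs.add (hY σ).abs
  have hmeas : ∀ t, AEStronglyMeasurable
      (fun ω => log (∑ σ, w σ * exp (cos t * X σ ω + sin t * Y σ ω))) μ := fun t =>
    AEMeasurable.aestronglyMeasurable (by fun_prop)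
  refine (hasDerivAt_integral_of_dominated_loc_of_deriv_le (μ := μ)
    (F := fun t ω => log (∑ σ, w σ * exp (cos t * X σ ω + sin t * Y σ ω)))
    (F' := fun t ω => ∑ σ, gibbsWeight w (fun τ => cos t * X τ ω + sin t * Y τ ω) σ *
      (-sin t * X σ ω + cos t * Y σ ω)) (bound := fun ω => ∑ σ, (|X σ ω| + |Y σ ω|))
    Filter.univ_mem (.of_forall hmeas) ?_ ?_ ?_ hbound ?_).2
  · refine hbound.mono' (hmeas θ) (.of_forall fun ω => ?_)
    exact (abs_log_sum_mul_exp_le hw hw1 _).trans (Finset.sum_le_sum fun σ _ =>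
      hle _ _ _ _ (abs_cos_le_one θ) (abs_sin_le_one θ))
  · have hZm : AEMeasurable (fun ω τ => cos θ * X τ ω + sin θ * Y τ ω) μ := by fun_prop
    exact (Finset.aemeasurable_fun_sum _ fun σ _ =>
      ((measurable_gibbsWeight w σ).comp_aemeasurable hZm).mul
        (by fun_prop)).aestronglyMeasurable
  · refine .of_forall fun ω t _ => ?_
    refine abs_sum_gibbsWeight_mul_le hw hw1 _ fun σ => ?_
    refine (hle _ _ _ _ (by rw [abs_neg]; exact abs_sin_le_one t) (abs_cos_le_one t)).trans ?_
    exact Finset.single_le_sum (f := fun σ => |X σ ω| + |Y σ ω|)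
      (fun τ _ => by positivity) (Finset.mem_univ σ)
  · refine .of_forall fun ω t _ => ?_
    exact hasDerivAt_log_sum_mul_exp hw hw1 fun σ =>
      ((hasDerivAt_cos t).mul_const _).add ((hasDerivAt_sin t).mul_const _)

/-- Gaussian integration by parts for the Gibbs average of a family `W` jointly Gaussian with the
energy `Z`. -/
lemma abs_integral_sum_gibbsWeight_mul_le {S Ω : Type*} [Fintype S] [MeasurableSpace Ω]
    {μ : Measure Ω} {W Z : S → Ω → ℝ}
    (hWZ : HasGaussianLaw (fun ω => (fun σ => W σ ω, fun σ => Z σ ω)) μ)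
    (hW : ∀ σ, ∫ ω, W σ ω ∂μ = 0) {M : ℝ} (hM : ∀ σ τ, |cov[W σ, Z τ; μ]| ≤ M)
    {w : S → ℝ} (hw : ∀ σ, 0 ≤ w σ) (hw1 : ∑ σ, w σ = 1) :
    |∫ ω, ∑ σ, gibbsWeight w (fun τ => Z τ ω) σ * W σ ω ∂μ| ≤ 2 * M := by
  have hμ := hWZ.isProbabilityMeasure
  set c : S → S → ℝ := fun σ τ => cov[W σ, Z τ; μ] with hc
  let d : S → (S → ℝ) → ℝ := fun σ z => c σ σ - ∑ τ, gibbsWeight w z τ * c σ τ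
  have hd : ∀ σ z, |d σ z| ≤ 2 * M := fun σ z => by
    have h := abs_sub (c σ σ) (∑ τ, gibbsWeight w z τ * c σ τ)
    have := hM σ σ
    have := abs_sum_gibbsWeight_mul_le hw hw1 z (hM σ)
    exact h.trans (by linarith)
  have hZm : AEMeasurable (fun ω σ => Z σ ω) μ := hWZ.snd.aemeasurable
  have hgm : ∀ σ, AEStronglyMeasurable (fun ω => gibbsWeight w (fun τ => Z τ ω) σ) μ := fun σ =>
    ((measurable_gibbsWeight w σ).comp_aemeasurable hZm).aestronglyMeasurable
  have hdm : ∀ σ, Measurable (d σ) := fun σ => by fun_prop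
  have hg : ∀ z σ, |gibbsWeight w z σ| ≤ 1 := fun z σ => by
    rw [abs_of_nonneg (gibbsWeight_nonneg hw z σ)]
    exact gibbsWeight_le_one hw hw1 z σ
  have hgd : ∀ σ z, |gibbsWeight w z σ * d σ z| ≤ 2 * M := fun σ z => by
    rw [abs_mul]
    exact (mul_le_of_le_one_left (abs_nonneg _) (hg z σ)).trans (hd σ z)
  have ibp : ∀ σ, ∫ ω, gibbsWeight w (fun τ => Z τ ω) σ * W σ ω ∂μ =
      ∫ ω, gibbsWeight w (fun τ => Z τ ω) σ * d σ (fun τ => Z τ ω) ∂μ := by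
    intro σ
    have hlaw : HasGaussianLaw (fun ω => (W σ ω, fun τ => Z τ ω)) μ :=
      hWZ.map_fun (((ContinuousLinearMap.proj (R := ℝ) (φ := fun _ : S => ℝ) σ).comp
        (ContinuousLinearMap.fst ℝ (S → ℝ) (S → ℝ))).prod
        (ContinuousLinearMap.snd ℝ (S → ℝ) (S → ℝ)))
    rw [← hlaw.integral_mul_comp_eq_integral_lineDeriv (hW σ) (f := fun z => gibbsWeight w z σ)
      (f' := fun z => gibbsWeight w z σ * d σ z) ?_ (measurable_gibbsWeight w σ)
      ((measurable_gibbsWeight w σ).mul (hdm σ)) (fun z => hg z σ) (hgd σ)]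
    · simp only [mul_comm]
    · intro z
      have h := hasDerivAt_gibbsWeight hw hw1 (z := fun t => z + t • c σ) (z' := c σ) (t := 0)
        (fun τ => by
          simpa using ((hasDerivAt_id (0 : ℝ)).mul_const (c σ τ)).const_add (z τ)) σ
      simpa [HasLineDerivAt, d] using h
  rw [integral_finsetSum _ fun σ _ => ?_, Finset.sum_congr rfl fun σ _ => ibp σ,
    ← integral_finsetSum _ fun σ _ => ?_]
  · rw [← Real.norm_eq_abs]
    refine le_trans (norm_integral_le_of_norm_le_const (C := 2 * M) (.of_forall fun ω => ?_)) ?_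
    · exact abs_sum_gibbsWeight_mul_le hw hw1 _ fun σ => hd σ _
    · simp
  · exact Integrable.of_bound ((hgm σ).mul ((hdm σ).comp_aemeasurable hZm).aestronglyMeasurable) (2 * M)
      (.of_forall fun ω => hgd σ _)
  · exact (hWZ.fst.eval σ).integrable.bdd_mul (hgm σ) (.of_forall fun ω => hg _ σ)

/-- Abstract Gaussian interpolation estimate. Let `X, Y` be two
independent centered (jointly) Gaussian vectors indexed by a finite set `S`, whose
covariances differ by at most `δ` entrywise. Then for any probability weight `w` on
`S`, `|E log ∑_σ w(σ)e^{X_σ} - E log ∑_σ w(σ)e^{Y_σ}| ≤ δ`. -/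
theorem gaussian_interpolation_free_energy_bound
    {S : Type*} [Fintype S] [Nonempty S]
    {Ω : Type*} [MeasurableSpace Ω] (μ : Measure Ω) [IsProbabilityMeasure μ]
    (X Y : S → Ω → ℝ) (hmX : ∀ σ, Measurable (X σ)) (hmY : ∀ σ, Measurable (Y σ))
    (hGauss : ∀ c c' : S → ℝ, ∃ u : NNReal,
      Measure.map (fun ω => ∑ σ, (c σ * X σ ω + c' σ * Y σ ω)) μ = gaussianReal 0 u)
    (hIndep : IndepFun (fun ω σ => X σ ω) (fun ω σ => Y σ ω) μ)
    (δ : ℝ)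
    (hCov : ∀ σ τ : S,
      |(∫ ω, X σ ω * X τ ω ∂μ) - ∫ ω, Y σ ω * Y τ ω ∂μ| ≤ δ)
    (w : S → ℝ) (hw : ∀ σ, 0 ≤ w σ) (hw1 : ∑ σ, w σ = 1) :
    |(∫ ω, Real.log (∑ σ, w σ * Real.exp (X σ ω)) ∂μ)
        - ∫ ω, Real.log (∑ σ, w σ * Real.exp (Y σ ω)) ∂μ| ≤ δ := by
  classical
  have hXY : HasGaussianLaw (fun ω => (fun σ => X σ ω, fun σ => Y σ ω)) μ :=
    hasGaussianLaw_prodMk_of_forall_sum hmX hmY fun c c' => ⟨0, hGauss c c'⟩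
  have mean_zero : ∀ c c' : S → ℝ, ∫ ω, ∑ σ, (c σ * X σ ω + c' σ * Y σ ω) ∂μ = 0 := by
    intro c c'
    obtain ⟨u, hu⟩ := hGauss c c'
    rw [← integral_map (φ := fun ω => ∑ σ, (c σ * X σ ω + c' σ * Y σ ω)) (f := fun x => x)
      (by fun_prop) (by fun_prop), hu, integral_id_gaussianReal]
  have hX0 : ∀ σ, ∫ ω, X σ ω ∂μ = 0 := fun σ => by
    simpa [Pi.single_apply] using mean_zero (Pi.single σ 1) 0
  have hY0 : ∀ σ, ∫ ω, Y σ ω ∂μ = 0 := fun σ => by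
    simpa [Pi.single_apply] using mean_zero 0 (Pi.single σ 1)
  have hX2 : ∀ σ, MemLp (X σ) 2 μ := fun σ => (hXY.fst.eval σ).memLp_two
  have hY2 : ∀ σ, MemLp (Y σ) 2 μ := fun σ => (hXY.snd.eval σ).memLp_two
  have hX1 : ∀ σ, Integrable (X σ) μ := fun σ => (hXY.fst.eval σ).integrable
  have hY1 : ∀ σ, Integrable (Y σ) μ := fun σ => (hXY.snd.eval σ).integrable
  have hcross : ∀ σ τ, cov[X σ, Y τ; μ] = 0 := fun σ τ =>
    (hIndep.comp (measurable_pi_apply σ) (measurable_pi_apply τ)).covariance_eq_zero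
      (hX2 σ) (hY2 τ)
  have hcovdiff : ∀ σ τ, |cov[Y σ, Y τ; μ] - cov[X σ, X τ; μ]| ≤ δ := fun σ τ => by
    rw [covariance_eq_sub (hX2 σ) (hX2 τ), covariance_eq_sub (hY2 σ) (hY2 τ), hX0 σ, hY0 σ,
      zero_mul, zero_mul, sub_zero, sub_zero, abs_sub_comm]
    exact hCov σ τ
  set φ : ℝ → ℝ := fun t => ∫ ω, log (∑ σ, w σ * exp (cos t * X σ ω + sin t * Y σ ω)) ∂μ with hφ
  have hderiv := hasDerivAt_integral_log_sum_mul_exp_rotation hX1 hY1 hw hw1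
  have hcovWZ : ∀ θ σ τ, cov[fun ω => -sin θ * X σ ω + cos θ * Y σ ω,
      fun ω => cos θ * X τ ω + sin θ * Y τ ω; μ] =
      sin θ * cos θ * (cov[Y σ, Y τ; μ] - cov[X σ, X τ; μ]) := by
    intro θ σ τ
    change cov[(fun ω => -sin θ * X σ ω) + fun ω => cos θ * Y σ ω,
      (fun ω => cos θ * X τ ω) + fun ω => sin θ * Y τ ω; μ] = _
    rw [covariance_add_left ((hX2 σ).const_mul _) ((hY2 σ).const_mul _)
        (((hX2 τ).const_mul _).add ((hY2 τ).const_mul _)),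
      covariance_add_right ((hX2 σ).const_mul _) ((hX2 τ).const_mul _) ((hY2 τ).const_mul _),
      covariance_add_right ((hY2 σ).const_mul _) ((hX2 τ).const_mul _) ((hY2 τ).const_mul _)]
    simp only [covariance_const_mul_left, covariance_const_mul_right, hcross,
      covariance_comm (Y σ) (X τ)]
    ring
  have hbound : ∀ θ ∈ Set.Ico 0 (π / 2),
      ‖∫ ω, ∑ σ, gibbsWeight w (fun τ => cos θ * X τ ω + sin θ * Y τ ω) σ *
        (-sin θ * X σ ω + cos θ * Y σ ω) ∂μ‖ ≤ δ * (2 * sin θ * cos θ) := by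
    intro θ hθ
    have hs : 0 ≤ sin θ := sin_nonneg_of_nonneg_of_le_pi hθ.1 (by linarith [hθ.2, pi_pos])
    have hco : 0 ≤ cos θ := cos_nonneg_of_mem_Icc ⟨by linarith [hθ.1, pi_pos], hθ.2.le⟩
    let A := ContinuousLinearMap.fst ℝ (S → ℝ) (S → ℝ)
    let B := ContinuousLinearMap.snd ℝ (S → ℝ) (S → ℝ)
    have hlaw : HasGaussianLaw (fun ω => (fun σ => -sin θ * X σ ω + cos θ * Y σ ω,
        fun σ => cos θ * X σ ω + sin θ * Y σ ω)) μ :=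
      hXY.map_fun ((-sin θ • A + cos θ • B).prod (cos θ • A + sin θ • B))
    have h := abs_integral_sum_gibbsWeight_mul_le
      (W := fun σ ω => -sin θ * X σ ω + cos θ * Y σ ω)
      (Z := fun σ ω => cos θ * X σ ω + sin θ * Y σ ω) (M := sin θ * cos θ * δ) hlaw
      (fun σ => by
        rw [integral_add ((hX1 σ).const_mul _) ((hY1 σ).const_mul _), integral_const_mul,
          integral_const_mul, hX0, hY0, mul_zero, mul_zero, add_zero])
      (fun σ τ => by
        rw [hcovWZ, abs_mul, abs_of_nonneg (mul_nonneg hs hco)]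
        exact mul_le_mul_of_nonneg_left (hcovdiff σ τ) (mul_nonneg hs hco)) hw hw1
    exact h.trans_eq (by ring)
  have hB : ∀ t, HasDerivAt (fun t => δ * sin t ^ 2) (δ * (2 * sin t * cos t)) t := fun t =>
    (((hasDerivAt_sin t).pow 2).const_mul δ).congr_deriv (by simp)
  have key := image_norm_le_of_norm_deriv_right_le_deriv_boundary (f := fun t => φ t - φ 0)
    (a := 0) (b := π / 2)
    (fun t _ => ((hderiv t).sub_const (φ 0)).continuousAt.continuousWithinAt)
    (fun t _ => ((hderiv t).sub_const (φ 0)).hasDerivWithinAt) (by simp) hB hbound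
    (Set.right_mem_Icc.2 (by positivity))
  rw [abs_sub_comm]
  simpa [hφ] using key
end
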